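/- Let μ and ν be centered (mean-zero) log-concave probability measures on ℤ, and let X and Y be random variables with distributions μ and ν respectively. Then for all 1 ≤ p ≤ q, W_q^q(μ, ν) ≤ 2·W_p^p(μ, ν) + 8^{q−p}·(2·max{E[|X|], E[|Y|]} + 1)^{q−p} · W_p^p(μ, ν) · log^{q−p}( 2^q·(E[|X|] + E[|Y|] + 1)^q·√Γ(2q + 1) / W_p^p(μ, ν) ). -/

import Mathlib

open MeasureTheory ProbabilityTheory
open scoped ProbabilityTheory

/-- A function `p : ℤ → ℝ` is a log-concave probability mass function if
`p(k)² ≥ p(k-1)·p(k+1)` for all `k ∈ ℤ` and its support is an integer interval. -/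
def IsLogConcavePMF (p : ℤ → ℝ) : Prop :=
  (∀ k : ℤ, p (k - 1) * p (k + 1) ≤ p k ^ 2) ∧
  (∀ a b c : ℤ, a ≤ b → b ≤ c → 0 < p a → 0 < p c → 0 < p b)

/-- `W_r^r(μ,ν) = inf E[|X − Y|^r]`, the `r`-th power of the `r`-th Wasserstein
distance, the infimum running over all couplings of `μ` and `ν`. -/
noncomputable def WassersteinPow (r : ℝ) (μ ν : Measure ℤ) : ℝ :=
  (⨅ π ∈ {π : Measure (ℤ × ℤ) | π.map Prod.fst = μ ∧ π.map Prod.snd = ν},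
    ∫⁻ x, ENNReal.ofReal (|(x.1 : ℝ) - (x.2 : ℝ)| ^ r) ∂π).toReal


lemma lc_four {u : ℤ → ℝ} (h0 : ∀ k, 0 ≤ u k) (h : IsLogConcavePMF u) (a : ℤ) (n : ℕ) :
    u a * u (a + n + 1) ≤ u (a + 1) * u (a + n) := by
  induction n with
  | zero => simp [mul_comm]
  | succ n ih =>
    push_cast
    rcases (h0 a).eq_or_lt with ha | ha
    · rw [← ha, zero_mul]; exact mul_nonneg (h0 _) (h0 _)
    rcases (h0 (a + (n + 1) + 1)).eq_or_lt with hb | hb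
    · rw [← hb, mul_zero]; exact mul_nonneg (h0 _) (h0 _)
    have h1 : 0 < u (a + n) := h.2 a (a + n) (a + (n + 1) + 1) (by omega) (by omega) ha hb
    have h2 := h.1 (a + n + 1)
    rw [show a + (n:ℤ) + 1 - 1 = a + n by ring, show a + (n:ℤ) + 1 + 1 = a + (n + 1) + 1 by ring,
      show a + (n:ℤ) + 1 = a + (n + 1) by ring] at h2
    rw [show a + (n:ℤ) + 1 = a + (n + 1) by ring] at ih
    have h3 := h0 (a + (n + 1))
    have : u (a + n) * (u a * u (a + (n + 1) + 1)) ≤ u (a + n) * (u (a + 1) * u (a + (n + 1))) := by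
      nlinarith [mul_le_mul_of_nonneg_left h2 ha.le, mul_le_mul_of_nonneg_right ih h3]
    exact le_of_mul_le_mul_left this h1

/-- tail -/
noncomputable def tl (μ : Measure ℤ) (k : ℤ) : ℝ := μ.real (Set.Ici k)

lemma tl_nonneg (μ : Measure ℤ) (k : ℤ) : 0 ≤ tl μ k := measureReal_nonneg

lemma tl_le_one (μ : Measure ℤ) [IsProbabilityMeasure μ] (k : ℤ) : tl μ k ≤ 1 :=
  measureReal_le_one

lemma tl_anti (μ : Measure ℤ) [IsProbabilityMeasure μ] {j k : ℤ} (h : j ≤ k) : tl μ k ≤ tl μ j :=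
  measureReal_mono (Set.Ici_subset_Ici.2 h)

lemma tl_succ (μ : Measure ℤ) [IsProbabilityMeasure μ] (k : ℤ) :
    tl μ k = μ.real {k} + tl μ (k + 1) := by
  unfold tl
  rw [← measureReal_union]
  · congr 1; ext x; simp; omega
  · rw [Set.disjoint_singleton_left]; simp
  · exact MeasurableSet.of_discrete

lemma tl_tendsto (μ : Measure ℤ) [IsProbabilityMeasure μ] (k : ℤ) :
    Filter.Tendsto (fun n : ℕ => tl μ (k + n)) Filter.atTop (nhds 0) := by
  have := tendsto_measure_iInter_atTop (μ := μ) (s := fun n : ℕ => Set.Ici (k + n))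
    (fun i => MeasurableSet.of_discrete.nullMeasurableSet)
    (fun i j hij => Set.Ici_subset_Ici.2 (by simpa using hij)) ⟨0, measure_ne_top _ _⟩
  have h2 : (⋂ n : ℕ, Set.Ici (k + (n:ℤ))) = ∅ := by
    ext x
    simp only [Set.mem_iInter, Set.mem_Ici, Set.mem_empty_iff_false, iff_false, not_forall, not_le]
    exact ⟨(x - k).toNat + 1, by push_cast; omega⟩
  rw [h2, measure_empty] at this
  simpa [tl, Measure.real, Function.comp_def] using (ENNReal.tendsto_toReal ENNReal.zero_ne_top).comp this

lemma tl_sum (μ : Measure ℤ) [IsProbabilityMeasure μ] (k : ℤ) :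
    HasSum (fun n : ℕ => μ.real {k + (n:ℤ)}) (tl μ k) := by
  rw [hasSum_iff_tendsto_nat_of_nonneg (fun _ => measureReal_nonneg)]
  have h : ∀ n : ℕ, ∑ i ∈ Finset.range n, μ.real {k + (i:ℤ)} = tl μ k - tl μ (k + n) := by
    intro n
    induction n with
    | zero => simp
    | succ n ih =>
      rw [Finset.sum_range_succ, ih]
      have := tl_succ μ (k + n)
      push_cast
      rw [← add_assoc]; linarith
  simp_rw [h]
  simpa using (tl_tendsto μ k).const_sub (tl μ k)

lemma tl_lc (μ : Measure ℤ) [IsProbabilityMeasure μ]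
    (h : IsLogConcavePMF (fun k => (μ {k}).toReal)) : IsLogConcavePMF (tl μ) := by
  constructor
  · intro k
    have h1 := tl_succ μ (k - 1)
    have h2 := tl_succ μ k
    rw [sub_add_cancel] at h1
    have key : μ.real {k - 1} * tl μ (k + 1) ≤ μ.real {k} * tl μ k := by
      refine hasSum_le ?_ ((tl_sum μ (k + 1)).mul_left _) ((tl_sum μ k).mul_left _)
      intro n
      have := lc_four (fun k => ENNReal.toReal_nonneg) h (k - 1) (n + 1)
      simp only [sub_add_cancel] at this
      push_cast at this
      rw [show k - 1 + ((n:ℤ) + 1) + 1 = k + 1 + n by ring,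
        show k - 1 + ((n:ℤ) + 1) = k + n by ring] at this
      exact this
    have h3 : tl μ k * tl μ k = (μ.real {k} + tl μ (k + 1)) * tl μ k := congrArg (· * tl μ k) h2
    rw [h1]
    nlinarith
  · intro a b c hab hbc ha hc
    exact hc.trans_le (tl_anti μ hbc)

lemma tl_summable (μ : Measure ℤ) [IsProbabilityMeasure μ]
    (h : IsLogConcavePMF (fun k => (μ {k}).toReal)) :
    Summable (fun n : ℕ => tl μ ((n:ℤ) + 1)) := by
  have hlc := tl_lc μ h
  have ht : Filter.Tendsto (fun n : ℕ => tl μ ((n:ℤ) + 1)) Filter.atTop (nhds 0) := by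
    simpa [add_comm] using tl_tendsto μ 1
  by_cases hK : ∃ K : ℕ, 0 < tl μ ((K:ℤ) + 1) ∧ tl μ ((K:ℤ) + 2) < tl μ ((K:ℤ) + 1)
  · obtain ⟨K, h1, h2⟩ := hK
    set ρ := tl μ ((K:ℤ) + 2) / tl μ ((K:ℤ) + 1) with hρ
    have hρ1 : ρ < 1 := (div_lt_one h1).2 h2
    have hρ0 : 0 ≤ ρ := div_nonneg (tl_nonneg _ _) (tl_nonneg _ _)
    rw [← summable_nat_add_iff K]
    refine Summable.of_nonneg_of_le (fun _ => tl_nonneg _ _) (f := fun n => tl μ ((K:ℤ) + 1) * ρ ^ n) ?_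
      ((summable_geometric_of_lt_one hρ0 hρ1).mul_left _)
    intro n
    induction n with
    | zero => simp
    | succ n ih =>
      have h3 := lc_four (tl_nonneg μ) hlc ((K:ℤ) + 1) n
      push_cast at ih ⊢
      rw [show (n:ℤ) + 1 + K + 1 = K + 1 + n + 1 by ring]
      rw [show (n:ℤ) + K + 1 = K + 1 + n by ring] at ih
      rw [show (K:ℤ) + 1 + 1 = K + 2 by ring] at h3
      have h4 : tl μ ((K:ℤ) + 2) = ρ * tl μ ((K:ℤ) + 1) := by rw [hρ]; field_simp
      rw [h4] at h3
      have h5 : tl μ ((K:ℤ) + 1 + n + 1) ≤ ρ * tl μ ((K:ℤ) + 1 + n) := by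
        refine le_of_mul_le_mul_left ?_ h1
        linarith
      calc _ ≤ _ := h5
        _ ≤ ρ * (tl μ ((K:ℤ) + 1) * ρ ^ n) := by gcongr
        _ = _ := by ring
  · push Not at hK
    have h0 : tl μ 1 ≤ 0 := by
      by_contra! hc
      have : ∀ n : ℕ, tl μ 1 ≤ tl μ ((n:ℤ) + 1) := by
        intro n
        induction n with
        | zero => simp
        | succ n ih =>
          have := hK n (hc.trans_le ih)
          push_cast
          rw [show (n:ℤ) + 1 + 1 = n + 2 by ring]
          linarith
      have := ge_of_tendsto' ht this
      linarith
    have : (fun n : ℕ => tl μ ((n:ℤ) + 1)) = fun _ => 0 := by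
      ext n
      exact le_antisymm ((tl_anti μ (by omega)).trans h0) (tl_nonneg _ _)
    rw [this]; exact summable_zero

/-- Comparison of a log-concave sequence with a geometric one. -/
lemma geom_compare {u w g : ℕ → ℝ} {c ρ : ℝ} (hc : 0 < c) (hρ : 0 < ρ)
    (hu0 : u 0 = c) (hun : ∀ n, 0 ≤ u n)
    (hlc : ∀ m n, m ≤ n → u m * u (n + 1) ≤ u (m + 1) * u n)
    (hg : ∀ n, g n = c * ρ ^ n)
    (hs : ∃ a, HasSum (fun n => u (n + 1)) a ∧ HasSum (fun n => g (n + 1)) a)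
    (hw : Monotone w) {B : ℝ} (hw0 : ∀ n, 0 ≤ w n)
    (hB : ∀ N, ∑ n ∈ Finset.range N, w n * g (n + 1) ≤ B) (N : ℕ) :
    ∑ n ∈ Finset.range N, w n * u (n + 1) ≤ B := by
  classical
  obtain ⟨a, ha, ha'⟩ := hs
  have hex : ∃ n, u (n + 1) ≤ g (n + 1) := by
    by_contra! hcon
    exact lt_irrefl a (hasSum_lt (i := 0) (fun n => (hcon n).le) (hcon 0) ha' ha)
  set K := Nat.find hex with hK
  have hK1 : u (K + 1) ≤ g (K + 1) := Nat.find_spec hex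
  have hgpos : ∀ n, 0 < g n := fun n => by rw [hg]; positivity
  have hK2 : ∀ n, n < K → g (n + 1) ≤ u (n + 1) := fun n hn => (not_le.1 (Nat.find_min hex hn)).le
  have hK3 : g K ≤ u K := by
    rcases Nat.eq_zero_or_pos K with h | h
    · rw [h, hu0, hg]; simp
    · obtain ⟨m, hm⟩ := Nat.exists_eq_succ_of_ne_zero h.ne'
      have := hK2 m (by omega)
      rw [hm]; exact this
  have hgs : ∀ n, g (n + 1) = ρ * g n := fun n => by rw [hg, hg]; ring
  have hK4 : ∀ n, K ≤ n → u (n + 1) ≤ g (n + 1) := by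
    intro n hn
    induction n, hn using Nat.le_induction with
    | base => exact hK1
    | succ n hn ih =>
      have h1 := hlc K (n + 1) (by omega)
      have h2 : 0 < u K := (hgpos K).trans_le hK3
      have h3 : u (K + 1) ≤ ρ * u K := by
        rw [hgs] at hK1
        exact hK1.trans (by gcongr)
      have h4 : u K * u (n + 1 + 1) ≤ u K * (ρ * u (n + 1)) := by
        nlinarith [mul_le_mul_of_nonneg_right h3 (hun (n + 1))]
      have h5 := le_of_mul_le_mul_left h4 h2
      rw [hgs]
      exact h5.trans (by gcongr)
  have hlim : Filter.Tendsto (fun N => B + w K * (∑ n ∈ Finset.range N, u (n + 1) -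
      ∑ n ∈ Finset.range N, g (n + 1))) Filter.atTop (nhds (B + w K * (a - a))) :=
    ((ha.tendsto_sum_nat.sub ha'.tendsto_sum_nat).const_mul _).const_add _
  rw [sub_self, mul_zero, add_zero] at hlim
  refine ge_of_tendsto hlim ?_
  filter_upwards [Filter.eventually_ge_atTop N] with M hM
  have h1 : ∑ n ∈ Finset.range N, w n * u (n + 1) ≤ ∑ n ∈ Finset.range M, w n * u (n + 1) :=
    Finset.sum_le_sum_of_subset_of_nonneg (by simpa using hM)
      (fun i _ _ => mul_nonneg (hw0 _) (hun _))
  have h2 : ∑ n ∈ Finset.range M, (w n - w K) * (u (n + 1) - g (n + 1)) ≤ 0 := by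
    refine Finset.sum_nonpos fun n _ => ?_
    rcases lt_or_ge n K with h | h
    · exact mul_nonpos_of_nonpos_of_nonneg (by linarith [hw h.le]) (by linarith [hK2 n h])
    · exact mul_nonpos_of_nonneg_of_nonpos (by linarith [hw h]) (by linarith [hK4 n h])
  have h3 : ∑ n ∈ Finset.range M, (w n - w K) * (u (n + 1) - g (n + 1)) =
      ∑ n ∈ Finset.range M, w n * u (n + 1) - ∑ n ∈ Finset.range M, w n * g (n + 1) -
      w K * (∑ n ∈ Finset.range M, u (n + 1) - ∑ n ∈ Finset.range M, g (n + 1)) := by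
    rw [← Finset.sum_sub_distrib, ← Finset.sum_sub_distrib, Finset.mul_sum, ← Finset.sum_sub_distrib]
    exact Finset.sum_congr rfl fun n _ => by ring
  have := hB M
  linarith

lemma geom_moment {r lam : ℝ} (hr : 1 ≤ r) (hl : 0 < lam) (N : ℕ) :
    ∑ n ∈ Finset.range N, (((n:ℝ) + 1) ^ r - (n:ℝ) ^ r) * Real.exp (-lam * (n + 1)) ≤
      Real.Gamma (r + 1) / lam ^ r := by
  have hint : IntegrableOn (fun t : ℝ => t ^ (r - 1) * Real.exp (-(lam * t))) (Set.Ioi 0) := by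
    have := integrableOn_rpow_mul_exp_neg_mul_rpow (s := r - 1) (p := 1) (b := lam) (by linarith) one_pos hl
    simpa using this
  have hG := Real.integral_rpow_mul_exp_neg_mul_Ioi (a := r) (r := lam) (by linarith) hl
  set f : ℝ → ℝ := fun t => r * (t ^ (r - 1) * Real.exp (-(lam * t))) with hf
  have hfc : Continuous f := by
    have : Continuous fun t : ℝ => t ^ (r - 1) := Real.continuous_rpow_const (by linarith)
    fun_prop
  have step : ∀ n : ℕ, (((n:ℝ) + 1) ^ r - (n:ℝ) ^ r) * Real.exp (-lam * (n + 1)) ≤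
      ∫ t in (n:ℝ)..((n+1 : ℕ):ℝ), f t := by
    intro n
    have h1 : ∫ t in (n:ℝ)..((n+1 : ℕ):ℝ), (r * t ^ (r - 1)) * Real.exp (-lam * (n + 1)) =
      (((n:ℝ) + 1) ^ r - (n:ℝ) ^ r) * Real.exp (-lam * (n + 1)) := by
      rw [intervalIntegral.integral_mul_const, intervalIntegral.integral_const_mul,
        integral_rpow (Or.inl (by linarith))]
      push_cast
      rw [sub_add_cancel]
      field_simp
    rw [← h1]
    have hc : Continuous fun t : ℝ => t ^ (r - 1) := Real.continuous_rpow_const (by linarith)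
    refine intervalIntegral.integral_mono_on (by simp) (Continuous.intervalIntegrable (by fun_prop) _ _)
      (hfc.intervalIntegrable _ _) ?_
    intro t ht
    push_cast at ht
    have ht0 : 0 ≤ t := le_trans (by positivity) ht.1
    rw [hf]
    simp only
    rw [← mul_assoc]
    have : 0 ≤ t ^ (r - 1) := Real.rpow_nonneg ht0 _
    gcongr
    nlinarith [ht.2]
  calc _ ≤ ∑ n ∈ Finset.range N, ∫ t in (n:ℝ)..((n+1 : ℕ):ℝ), f t := Finset.sum_le_sum fun n _ => step n
    _ = ∫ t in ((0:ℕ):ℝ)..(N:ℝ), f t :=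
      intervalIntegral.sum_integral_adjacent_intervals (a := fun n : ℕ => (n:ℝ)) (fun k _ => hfc.intervalIntegrable _ _)
    _ = ∫ t in Set.Ioc 0 (N:ℝ), f t := by
      rw [intervalIntegral.integral_of_le (by simp)]; simp
    _ ≤ ∫ t in Set.Ioi 0, f t := by
      refine setIntegral_mono_set (hint.const_mul r) ?_ (Set.Ioc_subset_Ioi_self).eventuallyLE
      refine (ae_restrict_mem measurableSet_Ioi).mono fun t ht => ?_
      have : (0:ℝ) < t := ht
      simp only [hf, Pi.zero_apply]
      positivity
    _ = _ := by
      simp only [hf]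
      rw [integral_const_mul, hG, Real.Gamma_add_one (by linarith), Real.div_rpow (by simp) hl.le, Real.one_rpow]
      ring

lemma w_mono {r : ℝ} (hr : 1 ≤ r) : Monotone (fun n : ℕ => ((n:ℝ) + 1) ^ r - (n:ℝ) ^ r) := by
  refine monotone_nat_of_le_succ fun n => ?_
  have h := (convexOn_rpow hr).2 (show (n:ℝ) ∈ Set.Ici 0 by simp)
    (show (n:ℝ) + 2 ∈ Set.Ici 0 by simp only [Set.mem_Ici]; positivity)
    (show (0:ℝ) ≤ 1 / 2 by norm_num) (show (0:ℝ) ≤ 1 / 2 by norm_num) (by norm_num)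
  simp only [smul_eq_mul] at h
  rw [show 1 / 2 * (n:ℝ) + 1 / 2 * (n + 2) = n + 1 by ring] at h
  push_cast
  rw [show (n:ℝ) + 1 + 1 = n + 2 by ring]
  linarith

lemma w_nonneg {r : ℝ} (hr : 1 ≤ r) (n : ℕ) : 0 ≤ ((n:ℝ) + 1) ^ r - (n:ℝ) ^ r := by
  have : (n:ℝ) ^ r ≤ ((n:ℝ) + 1) ^ r :=
    Real.rpow_le_rpow (by positivity) (by linarith) (by linarith)
  linarith

lemma lint_pos (μ : Measure ℤ) [IsProbabilityMeasure μ] {r : ℝ} (hr : 1 ≤ r) :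
    ∫⁻ x, ENNReal.ofReal ((x.toNat : ℝ) ^ r) ∂μ =
      ∑' n : ℕ, ENNReal.ofReal ((((n:ℝ) + 1) ^ r - (n:ℝ) ^ r) * tl μ ((n:ℤ) + 1)) := by
  have hpt : ∀ x : ℤ, ENNReal.ofReal ((x.toNat : ℝ) ^ r) = ∑' n : ℕ,
      (Set.Ici ((n:ℤ) + 1)).indicator (fun _ => ENNReal.ofReal (((n:ℝ) + 1) ^ r - (n:ℝ) ^ r)) x := by
    intro x
    rw [tsum_eq_sum (s := Finset.range x.toNat)]
    · rw [Finset.sum_congr rfl (g := fun n : ℕ => ENNReal.ofReal (((n:ℝ) + 1) ^ r - (n:ℝ) ^ r))]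
      · rw [← ENNReal.ofReal_sum_of_nonneg (fun i _ => w_nonneg hr i)]
        congr 1
        have := Finset.sum_range_sub (fun n : ℕ => (n:ℝ) ^ r) x.toNat
        push_cast at this
        rw [this, Real.zero_rpow (by linarith), sub_zero]
      · intro n hn
        rw [Set.indicator_of_mem]
        simp only [Finset.mem_range] at hn
        simp only [Set.mem_Ici]; omega
    · intro n hn
      rw [Set.indicator_of_notMem]
      simp only [Finset.mem_range] at hn
      simp only [Set.mem_Ici]; omega
  simp_rw [hpt]
  rw [lintegral_tsum (fun _ => Measurable.aemeasurable Measurable.of_discrete)]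
  congr 1
  ext n
  rw [lintegral_indicator MeasurableSet.of_discrete, lintegral_const, ENNReal.ofReal_mul (w_nonneg hr n)]
  simp [tl]

lemma lint_pos_one (μ : Measure ℤ) [IsProbabilityMeasure μ]
    (h : IsLogConcavePMF (fun k => (μ {k}).toReal)) :
    ∫⁻ x, ENNReal.ofReal (x.toNat : ℝ) ∂μ = ENNReal.ofReal (∑' n : ℕ, tl μ ((n:ℤ) + 1)) := by
  have := lint_pos μ (le_refl 1)
  simp only [Real.rpow_one, add_sub_cancel_left, one_mul] at this
  rw [this, ENNReal.ofReal_tsum_of_nonneg (fun _ => tl_nonneg _ _) (tl_summable μ h)]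

lemma pos_moment (μ : Measure ℤ) [IsProbabilityMeasure μ]
    (h : IsLogConcavePMF (fun k => (μ {k}).toReal)) (hc : 0 < tl μ 0) {r a : ℝ} (hr : 1 ≤ r)
    (ha : a = ∑' n : ℕ, tl μ ((n:ℤ) + 1)) :
    ∫⁻ x, ENNReal.ofReal ((x.toNat : ℝ) ^ r) ∂μ ≤
      ENNReal.ofReal (tl μ 0 * (Real.Gamma (r + 1) * (a / tl μ 0 + 1 / 2) ^ r)) := by
  have hsum := tl_summable μ h
  have ha0 : 0 ≤ a := ha ▸ tsum_nonneg fun _ => tl_nonneg _ _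
  have hG : 0 < Real.Gamma (r + 1) := Real.Gamma_pos_of_pos (by linarith)
  rw [lint_pos μ hr]
  rw [ENNReal.tsum_eq_iSup_nat]
  refine iSup_le fun N => ?_
  rw [← ENNReal.ofReal_sum_of_nonneg (fun i _ => mul_nonneg (w_nonneg hr i) (tl_nonneg _ _))]
  refine ENNReal.ofReal_le_ofReal ?_
  rcases ha0.eq_or_lt with h0 | h0
  · have hz : ∀ n : ℕ, tl μ ((n:ℤ) + 1) = 0 := by
      have := (hasSum_zero_iff_of_nonneg (f := fun n : ℕ => tl μ ((n:ℤ) + 1)) (fun _ => tl_nonneg _ _)).1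
        (by rw [h0, ha]; exact hsum.hasSum)
      intro n; exact congrFun this n
    simp only [hz, mul_zero, Finset.sum_const_zero]
    positivity
  set c := tl μ 0 with hcdef
  set ρ := a / (a + c) with hρ
  have hρ0 : 0 < ρ := by positivity
  have hρ1 : ρ < 1 := (div_lt_one (by positivity)).2 (by linarith)
  set lam := -Real.log ρ with hlam
  have hl0 : 0 < lam := by have := Real.log_neg hρ0 hρ1; linarith
  have hl1 : 1 / lam ≤ a / c + 1 / 2 := by
    have h1 : lam = Real.log (1 + c / a) := by
      rw [hlam, hρ, ← Real.log_inv]; congr 1; field_simp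
    have h2 := Real.le_log_one_add_of_nonneg (x := c / a) (by positivity)
    rw [← h1] at h2
    rw [div_le_iff₀ hl0]
    calc (1:ℝ) = (a / c + 1 / 2) * (2 * (c / a) / (c / a + 2)) := by field_simp; ring
      _ ≤ _ := by gcongr
  have key := geom_compare (u := fun n : ℕ => tl μ (n:ℤ)) (w := fun n : ℕ => ((n:ℝ) + 1) ^ r - (n:ℝ) ^ r)
    (g := fun n => c * ρ ^ n) (c := c) (ρ := ρ) (B := c * (Real.Gamma (r + 1) / lam ^ r)) hc hρ0 (by simp [hcdef])
    (fun n => tl_nonneg _ _) ?_ (fun n => rfl) ⟨a, ?_, ?_⟩ (w_mono hr) (w_nonneg hr) ?_ N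
  · push_cast at key
    refine key.trans ?_
    rw [div_eq_mul_one_div, show 1 / lam ^ r = (1 / lam) ^ r by
      rw [Real.div_rpow zero_le_one hl0.le, Real.one_rpow]]
    gcongr
  · intro m n hmn
    have := lc_four (tl_nonneg μ) (tl_lc μ h) m (n - m)
    rw [Nat.cast_sub hmn] at this
    push_cast
    rwa [show (m:ℤ) + (n - m) = n by ring] at this
  · push_cast; rw [ha]; exact hsum.hasSum
  · have := (hasSum_geometric_of_lt_one hρ0.le hρ1).mul_left (c * ρ)
    have h1 : 1 - ρ = c / (a + c) := by rw [hρ]; field_simp; ring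
    have h2 : c * ρ * (1 - ρ)⁻¹ = a := by rw [h1, hρ]; field_simp
    rw [h2] at this
    simpa only [pow_succ', mul_assoc] using this
  · intro M
    have := mul_le_mul_of_nonneg_left (geom_moment hr hl0 M) hc.le
    refine le_trans (le_of_eq ?_) this
    rw [Finset.mul_sum]
    refine Finset.sum_congr rfl fun n _ => ?_
    have : Real.exp (-lam * (n + 1)) = ρ ^ (n + 1) := by
      rw [hlam, neg_neg, mul_comm, ← Nat.cast_add_one, Real.exp_nat_mul, Real.exp_log hρ0]
    rw [this]; ring

/-- supergradient -/
lemma supergrad (μ : Measure ℤ) [IsProbabilityMeasure μ]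
    (h : IsLogConcavePMF (fun k => (μ {k}).toReal)) (hc : 0 < tl μ 0) :
    ∃ θ : ℝ, ∀ k : ℤ, 0 < tl μ k → 1 + k * θ ≤ √(tl μ 0) / √(tl μ k) := by
  have hlc := tl_lc μ h
  rcases (tl_nonneg μ 1).eq_or_lt with h1 | h1
  · refine ⟨1, fun k hk => ?_⟩
    have hk0 : k ≤ 0 := by
      by_contra! hcon
      have := tl_anti μ (show (1:ℤ) ≤ k by omega)
      linarith
    rcases hk0.eq_or_lt with h2 | h2
    · subst h2
      have := Real.sqrt_pos.2 hk
      simp [div_self this.ne']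
    · have : (k:ℝ) ≤ -1 := by exact_mod_cast (show k ≤ -1 by omega)
      have : 0 ≤ √(tl μ 0) / √(tl μ k) := by positivity
      linarith
  · set t := Real.log (tl μ 1 / tl μ 0) with ht
    have he : Real.exp t = tl μ 1 / tl μ 0 := Real.exp_log (by positivity)
    have hb : ∀ k : ℤ, tl μ k ≤ tl μ 0 * Real.exp (t * k) := by
      intro k
      obtain ⟨n, rfl | rfl⟩ := k.eq_nat_or_neg
      · induction n with
        | zero => simp
        | succ n ih =>
          have h3 := lc_four (tl_nonneg μ) hlc 0 n
          simp only [zero_add] at h3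
          push_cast at ih ⊢
          rw [mul_add, Real.exp_add, mul_one, he]
          have h4 : tl μ ((n:ℤ) + 1) ≤ tl μ 1 / tl μ 0 * tl μ n := by
            rw [div_mul_eq_mul_div, le_div_iff₀ hc]; linarith
          calc _ ≤ _ := h4
            _ ≤ tl μ 1 / tl μ 0 * (tl μ 0 * Real.exp (t * n)) := by gcongr
            _ = _ := by ring
      · induction n with
        | zero => simp
        | succ n ih =>
          have h3 := lc_four (tl_nonneg μ) hlc (-(n:ℤ) - 1) (n + 1)
          push_cast at h3 ih ⊢
          rw [show -(n:ℤ) - 1 + (n + 1) = 0 by ring, zero_add, sub_add_cancel] at h3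
          rw [show t * (-((n:ℝ) + 1)) = t * -n + -t by ring, Real.exp_add, Real.exp_neg, he]
          have h4 : tl μ (-((n:ℤ) + 1)) ≤ (tl μ 1 / tl μ 0)⁻¹ * tl μ (-n) := by
            rw [inv_div, div_mul_eq_mul_div, le_div_iff₀ h1,
              show -((n:ℤ) + 1) = -n - 1 by ring]; linarith
          calc _ ≤ _ := h4
            _ ≤ (tl μ 1 / tl μ 0)⁻¹ * (tl μ 0 * Real.exp (t * -n)) := by gcongr
            _ = _ := by ring
    refine ⟨-t / 2, fun k hk => ?_⟩
    have h5 := Real.add_one_le_exp (k * (-t / 2))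
    refine le_trans (by linarith) (h5.trans ?_)
    rw [le_div_iff₀ (Real.sqrt_pos.2 hk)]
    refine Real.le_sqrt_of_sq_le ?_
    rw [mul_pow, Real.sq_sqrt hk.le, ← Real.exp_nat_mul]
    calc _ ≤ Real.exp ((2:ℕ) * (k * (-t / 2))) * (tl μ 0 * Real.exp (t * k)) := by gcongr; exact hb k
      _ = tl μ 0 * (Real.exp ((2:ℕ) * (k * (-t / 2))) * Real.exp (t * k)) := by ring
      _ = tl μ 0 := by
        rw [← Real.exp_add, show ((2:ℕ):ℝ) * (k * (-t / 2)) + t * k = 0 by push_cast; ring, Real.exp_zero, mul_one]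

lemma lint_inv_sqrt (μ : Measure ℤ) [IsProbabilityMeasure μ] :
    ∫⁻ x, ENNReal.ofReal (1 / √(tl μ x)) ∂μ ≤ 2 := by
  rw [lintegral_countable']
  have hterm : ∀ k : ℤ, ENNReal.ofReal (1 / √(tl μ k)) * μ {k} =
      ENNReal.ofReal (1 / √(tl μ k) * μ.real {k}) := by
    intro k
    rw [ENNReal.ofReal_mul (by positivity)]
    simp
  simp_rw [hterm]
  rw [ENNReal.tsum_eq_iSup_sum]
  refine iSup_le fun s => ?_
  rw [← ENNReal.ofReal_sum_of_nonneg (fun i _ => by positivity)]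
  rw [show (2:ENNReal) = ENNReal.ofReal 2 by simp]
  refine ENNReal.ofReal_le_ofReal ?_
  have hstep : ∀ k : ℤ, 1 / √(tl μ k) * μ.real {k} ≤ 2 * (√(tl μ k) - √(tl μ (k + 1))) := by
    intro k
    have h1 := tl_succ μ k
    have h2 : √(tl μ (k + 1)) ≤ √(tl μ k) := Real.sqrt_le_sqrt (tl_anti μ (by omega))
    rcases (tl_nonneg μ k).eq_or_lt with h0 | h0
    · rw [← h0]; simp
      rw [← h0] at h2; simp at h2; linarith
    · have h3 := Real.sqrt_pos.2 h0
      rw [div_mul_eq_mul_div, one_mul, div_le_iff₀ h3]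
      have h4 : μ.real {k} = √(tl μ k) ^ 2 - √(tl μ (k + 1)) ^ 2 := by
        rw [Real.sq_sqrt (tl_nonneg _ _), Real.sq_sqrt (tl_nonneg _ _)]; linarith
      rw [h4]
      nlinarith
  obtain ⟨L, hL⟩ := s.bddBelow
  obtain ⟨U, hU⟩ := s.bddAbove
  have hsub : s ⊆ (Finset.range (U + 1 - L).toNat).image (fun n : ℕ => L + n) := by
    intro k hk
    have := hL hk; have := hU hk
    simp only [Finset.mem_image, Finset.mem_range]
    exact ⟨(k - L).toNat, by omega, by omega⟩
  refine (Finset.sum_le_sum_of_subset_of_nonneg hsub (fun i _ _ => by positivity)).trans ?_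
  rw [Finset.sum_image (by intro a _ b _ hab; simpa using hab)]
  refine (Finset.sum_le_sum (fun (n : ℕ) _ => hstep (L + n))).trans ?_
  rw [← Finset.mul_sum]
  have := Finset.sum_range_sub' (fun n : ℕ => √(tl μ (L + n))) (U + 1 - L).toNat
  push_cast at this
  simp only [← add_assoc] at this
  rw [this]
  have h1 : √(tl μ (L + 0)) ≤ 1 := Real.sqrt_le_one.2 (tl_le_one _ _)
  have h2 := Real.sqrt_nonneg (tl μ (L + (U + 1 - L).toNat))
  linarith

lemma grunbaum (μ : Measure ℤ) [IsProbabilityMeasure μ]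
    (h : IsLogConcavePMF (fun k => (μ {k}).toReal)) (hi : Integrable (fun x : ℤ => (x:ℝ)) μ)
    (h0 : ∫ x : ℤ, (x:ℝ) ∂μ = 0) : 1 / 4 ≤ tl μ 0 := by
  have hae : ∀ᵐ x ∂μ, 0 < tl μ x := by
    rw [ae_iff_of_countable]
    intro k hk
    have h1 := tl_succ μ k
    have h2 := tl_nonneg μ (k + 1)
    have h3 : 0 < μ.real {k} := ENNReal.toReal_pos hk (measure_ne_top _ _)
    linarith
  have hc : 0 < tl μ 0 := by
    rcases (tl_nonneg μ 0).eq_or_lt with h1 | h1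
    · exfalso
      have : ∫ x : ℤ, (x:ℝ) ∂μ ≤ ∫ x : ℤ, (-1:ℝ) ∂μ := by
        refine integral_mono_ae hi (integrable_const _) ?_
        filter_upwards [hae] with x hx
        have : x ≤ -1 := by
          by_contra! hcon
          have := tl_anti μ (show (0:ℤ) ≤ x by omega)
          linarith
        exact_mod_cast this
      simp [h0] at this
      linarith
    · exact h1
  obtain ⟨θ, hθ⟩ := supergrad μ h hc
  have hint : Integrable (fun x => 1 / √(tl μ x)) μ := by
    refine ⟨(Measurable.of_discrete).aestronglyMeasurable, ?_⟩
    rw [hasFiniteIntegral_iff_ofReal (Filter.Eventually.of_forall fun x => by positivity)]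
    exact (lint_inv_sqrt μ).trans_lt (by simp)
  have h1 : ∫ x, 1 / √(tl μ x) ∂μ ≤ 2 := by
    rw [integral_eq_lintegral_of_nonneg_ae (Filter.Eventually.of_forall fun x => by positivity)
      (Measurable.of_discrete).aestronglyMeasurable]
    exact ENNReal.toReal_le_of_le_ofReal (by norm_num) (by simpa using lint_inv_sqrt μ)
  have h2 : ∫ x : ℤ, (1 + (x:ℝ) * θ) ∂μ ≤ ∫ x, √(tl μ 0) * (1 / √(tl μ x)) ∂μ := by
    refine integral_mono_ae ((integrable_const _).add (hi.mul_const _)) (hint.const_mul _) ?_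
    filter_upwards [hae] with x hx
    have := hθ x hx
    rwa [mul_one_div]
  rw [integral_add (integrable_const _) (hi.mul_const _), integral_mul_const, h0, integral_const_mul] at h2
  simp only [integral_const, probReal_univ, smul_eq_mul, mul_one, zero_mul, add_zero] at h2
  have h3 := Real.sqrt_pos.2 hc
  have h4 : 1 / 2 ≤ √(tl μ 0) := by nlinarith
  have h5 := Real.sq_sqrt hc.le
  nlinarith

lemma refl_lc (μ : Measure ℤ) (h : IsLogConcavePMF (fun k => (μ {k}).toReal)) :
    IsLogConcavePMF (fun k => ((μ.map (fun x : ℤ => -x)) {k}).toReal) := by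
  have e : ∀ k : ℤ, (μ.map (fun x : ℤ => -x)) {k} = μ {-k} := by
    intro k
    rw [Measure.map_apply Measurable.of_discrete MeasurableSet.of_discrete]
    congr 1; ext x; simp
  simp only [e]
  constructor
  · intro k
    have := h.1 (-k)
    simp only at this
    beta_reduce
    rw [show -(k - 1) = -k + 1 by ring, show -(k + 1) = -k - 1 by ring, mul_comm]
    exact this
  · intro a b c hab hbc ha hc
    exact h.2 (-c) (-b) (-a) (by omega) (by omega) hc ha

lemma abs_split (x : ℤ) {r : ℝ} (hr : 0 < r) :
    |(x:ℝ)| ^ r = (x.toNat : ℝ) ^ r + ((-x).toNat : ℝ) ^ r := by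
  obtain ⟨n, rfl | rfl⟩ := x.eq_nat_or_neg
  · simp [Real.zero_rpow hr.ne']
  · simp [Real.zero_rpow hr.ne']

lemma int_split (x : ℤ) : (x:ℝ) = (x.toNat : ℝ) - ((-x).toNat : ℝ) := by
  have : x = (x.toNat : ℤ) - ((-x).toNat : ℤ) := by omega
  exact_mod_cast this

lemma abs_moment (μ : Measure ℤ) [IsProbabilityMeasure μ]
    (h : IsLogConcavePMF (fun k => (μ {k}).toReal)) (h0 : ∫ x : ℤ, (x:ℝ) ∂μ = 0)
    {r : ℝ} (hr : 1 ≤ r) :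
    ∫⁻ x : ℤ, ENNReal.ofReal (|(x:ℝ)| ^ r) ∂μ ≤
      ENNReal.ofReal (Real.Gamma (r + 1) * (2 * (∫ x : ℤ, |(x:ℝ)| ∂μ) + 1) ^ r) := by
  set μ' := μ.map (fun x : ℤ => -x) with hμ'
  have hneg : Measurable (fun x : ℤ => -x) := Measurable.of_discrete
  have : IsProbabilityMeasure μ' := Measure.isProbabilityMeasure_map hneg.aemeasurable
  have h' := refl_lc μ h
  rw [← hμ'] at h'
  set a := ∑' n : ℕ, tl μ ((n:ℤ) + 1) with ha
  set a' := ∑' n : ℕ, tl μ' ((n:ℤ) + 1) with ha'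
  have ha0 : 0 ≤ a := tsum_nonneg fun _ => tl_nonneg _ _
  have ha0' : 0 ≤ a' := tsum_nonneg fun _ => tl_nonneg _ _
  have hP := lint_pos_one μ h
  have hN := lint_pos_one μ' h'
  rw [← ha] at hP
  rw [← ha', hμ', lintegral_map Measurable.of_discrete hneg] at hN
  have hiP : Integrable (fun x : ℤ => (x.toNat : ℝ)) μ := by
    refine ⟨(Measurable.of_discrete).aestronglyMeasurable, ?_⟩
    rw [hasFiniteIntegral_iff_ofReal (Filter.Eventually.of_forall fun x => by positivity), hP]
    exact ENNReal.ofReal_lt_top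
  have hiN : Integrable (fun x : ℤ => ((-x).toNat : ℝ)) μ := by
    refine ⟨(Measurable.of_discrete).aestronglyMeasurable, ?_⟩
    rw [hasFiniteIntegral_iff_ofReal (Filter.Eventually.of_forall fun x => by positivity), hN]
    exact ENNReal.ofReal_lt_top
  have hIP : ∫ x : ℤ, (x.toNat : ℝ) ∂μ = a := by
    rw [integral_eq_lintegral_of_nonneg_ae (Filter.Eventually.of_forall fun x => by positivity)
      (Measurable.of_discrete).aestronglyMeasurable, hP, ENNReal.toReal_ofReal ha0]
  have hIN : ∫ x : ℤ, ((-x).toNat : ℝ) ∂μ = a' := by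
    rw [integral_eq_lintegral_of_nonneg_ae (Filter.Eventually.of_forall fun x => by positivity)
      (Measurable.of_discrete).aestronglyMeasurable, hN, ENNReal.toReal_ofReal ha0']
  have hi : Integrable (fun x : ℤ => (x:ℝ)) μ := by
    simp_rw [int_split]; exact hiP.sub hiN
  have haa : a' = a := by
    have : ∫ x : ℤ, (x:ℝ) ∂μ = a - a' := by
      rw [← hIP, ← hIN, ← integral_sub hiP hiN]
      exact integral_congr_ae (Filter.Eventually.of_forall fun x => int_split x)
    linarith
  have hE : ∫ x : ℤ, |(x:ℝ)| ∂μ = 2 * a := by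
    have : ∫ x : ℤ, |(x:ℝ)| ∂μ = a + a' := by
      rw [← hIP, ← hIN, ← integral_add hiP hiN]
      exact integral_congr_ae (Filter.Eventually.of_forall fun x => by
        simpa using abs_split x one_pos)
    linarith
  have hi' : Integrable (fun x : ℤ => (x:ℝ)) μ' := by
    rw [hμ', integrable_map_measure (Measurable.of_discrete).aestronglyMeasurable hneg.aemeasurable]
    simpa [Function.comp_def] using hi
  have h0' : ∫ x : ℤ, (x:ℝ) ∂μ' = 0 := by
    rw [hμ', integral_map hneg.aemeasurable (Measurable.of_discrete).aestronglyMeasurable]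
    simp [integral_neg, h0]
  have hc := grunbaum μ h hi h0
  have hc' := grunbaum μ' h' hi' h0'
  have m1 := pos_moment μ h (by linarith) hr ha
  have m2 := pos_moment μ' h' (by linarith) hr ha'
  rw [haa] at m2
  rw [hμ', lintegral_map Measurable.of_discrete hneg, ← hμ'] at m2
  have hG : 0 < Real.Gamma (r + 1) := Real.Gamma_pos_of_pos (by linarith)
  rw [hE]
  simp_rw [abs_split _ (show 0 < r by linarith)]
  rw [lintegral_congr fun x : ℤ => ENNReal.ofReal_add (p := (x.toNat:ℝ) ^ r)
    (q := ((-x).toNat:ℝ) ^ r) (by positivity) (by positivity)]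
  rw [lintegral_add_left Measurable.of_discrete]
  refine (add_le_add m1 m2).trans ?_
  rw [← ENNReal.ofReal_add (by positivity) (by positivity)]
  refine ENNReal.ofReal_le_ofReal ?_
  have key : ∀ c : ℝ, 1 / 4 ≤ c → c ≤ 1 →
      c * (a / c + 1 / 2) ^ r ≤ (a + 1 / 2) * (2 * (2 * a) + 1) ^ (r - 1) := by
    intro c hc1 hc2
    have hc0 : 0 < c := by linarith
    have e1 : 0 < a / c + 1 / 2 := by positivity
    have e2 : a / c + 1 / 2 ≤ 2 * (2 * a) + 1 := by
      have : a / c ≤ 4 * a := by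
        rw [div_le_iff₀ hc0]; nlinarith
      linarith
    calc c * (a / c + 1 / 2) ^ r = (c * (a / c + 1 / 2)) * (a / c + 1 / 2) ^ (r - 1) := by
          rw [mul_assoc, ← Real.rpow_one_add' e1.le (by linarith)]; congr 2; ring
      _ ≤ (a + 1 / 2) * (2 * (2 * a) + 1) ^ (r - 1) := by
          have : c * (a / c + 1 / 2) ≤ a + 1 / 2 := by
            rw [mul_add, mul_div_cancel₀ _ hc0.ne']; linarith
          have e3 : (a / c + 1 / 2) ^ (r - 1) ≤ (2 * (2 * a) + 1) ^ (r - 1) :=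
            Real.rpow_le_rpow e1.le e2 (by linarith)
          gcongr
  have k1 := key _ hc (tl_le_one _ _)
  have k2 := key _ hc' (tl_le_one _ _)
  have e4 : (2 * (2 * a) + 1) ^ r = (2 * (2 * a) + 1) * (2 * (2 * a) + 1) ^ (r - 1) := by
    rw [← Real.rpow_one_add' (by positivity) (by linarith)]; congr 1; ring
  have e5 : 0 ≤ (2 * (2 * a) + 1) ^ (r - 1) := by positivity
  calc _ = Real.Gamma (r + 1) * (tl μ 0 * (a / tl μ 0 + 1 / 2) ^ r + tl μ' 0 * (a / tl μ' 0 + 1 / 2) ^ r) := by ring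
    _ ≤ _ := by
      rw [e4]
      refine mul_le_mul_of_nonneg_left ?_ hG.le
      nlinarith [mul_nonneg ha0 e5]

lemma exp_tail (μ : Measure ℤ) [IsProbabilityMeasure μ]
    (h : IsLogConcavePMF (fun k => (μ {k}).toReal)) (h0 : ∫ x : ℤ, (x:ℝ) ∂μ = 0)
    {b : ℝ} (hb : 2 * (∫ x : ℤ, |(x:ℝ)| ∂μ) + 1 ≤ b) (t : ℝ) :
    μ {x : ℤ | t ≤ |(x:ℝ)|} ≤ ENNReal.ofReal (2 * Real.exp (-t / (2 * b))) := by
  have hE : 0 ≤ ∫ x : ℤ, |(x:ℝ)| ∂μ := integral_nonneg fun _ => abs_nonneg _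
  have hb0 : 0 < b := by linarith
  have hmgf : ∫⁻ x : ℤ, ENNReal.ofReal (Real.exp (|(x:ℝ)| / (2 * b))) ∂μ ≤ 2 := by
    have hpt : ∀ x : ℤ, ENNReal.ofReal (Real.exp (|(x:ℝ)| / (2 * b))) =
        ∑' n : ℕ, ENNReal.ofReal ((|(x:ℝ)| / (2 * b)) ^ n / n.factorial) := by
      intro x
      rw [← ENNReal.ofReal_tsum_of_nonneg (fun n => by positivity) (Real.summable_pow_div_factorial _),
        Real.exp_eq_exp_ℝ, NormedSpace.exp_eq_tsum_div]
    simp_rw [hpt]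
    rw [lintegral_tsum (fun _ => Measurable.aemeasurable Measurable.of_discrete)]
    have hterm : ∀ n : ℕ, ∫⁻ x : ℤ, ENNReal.ofReal ((|(x:ℝ)| / (2 * b)) ^ n / n.factorial) ∂μ ≤
        ENNReal.ofReal ((1 / 2) ^ n) := by
      intro n
      rcases Nat.eq_zero_or_pos n with hn | hn
      · subst hn; simp
      have hm := abs_moment μ h h0 (r := n) (by exact_mod_cast hn)
      simp only [Real.rpow_natCast, Real.Gamma_nat_eq_factorial] at hm
      have e : ∀ x : ℤ, ENNReal.ofReal ((|(x:ℝ)| / (2 * b)) ^ n / n.factorial) =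
          ENNReal.ofReal (1 / ((2 * b) ^ n * n.factorial)) * ENNReal.ofReal (|(x:ℝ)| ^ n) := by
        intro x
        rw [← ENNReal.ofReal_mul (by positivity)]
        congr 1; rw [div_pow]; field_simp
      simp_rw [e]
      rw [lintegral_const_mul _ Measurable.of_discrete]
      refine (mul_le_mul_right hm _).trans ?_
      rw [← ENNReal.ofReal_mul (by positivity)]
      refine ENNReal.ofReal_le_ofReal ?_
      calc _ ≤ 1 / ((2 * b) ^ n * n.factorial) * (n.factorial * b ^ n) := by gcongr
        _ = _ := by rw [mul_pow, div_pow, one_pow]; field_simp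
    refine (ENNReal.tsum_le_tsum hterm).trans ?_
    rw [← ENNReal.ofReal_tsum_of_nonneg (fun n => by positivity) summable_geometric_two,
      tsum_geometric_two]
    simp
  have hm := mul_meas_ge_le_lintegral (μ := μ)
    (f := fun x : ℤ => ENNReal.ofReal (Real.exp (|(x:ℝ)| / (2 * b)))) Measurable.of_discrete
    (ENNReal.ofReal (Real.exp (t / (2 * b))))
  have hset : {x : ℤ | t ≤ |(x:ℝ)|} ⊆ {x : ℤ | ENNReal.ofReal (Real.exp (t / (2 * b))) ≤
      ENNReal.ofReal (Real.exp (|(x:ℝ)| / (2 * b)))} := by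
    intro x hx
    simp only [Set.mem_ofPred_eq] at hx ⊢
    gcongr
  have hm2 := hm.trans hmgf
  refine (measure_mono hset).trans ?_
  rw [ENNReal.ofReal_mul (by norm_num), neg_div, Real.exp_neg, ENNReal.ofReal_inv_of_pos (Real.exp_pos _),
    ← div_eq_mul_inv]
  rw [ENNReal.le_div_iff_mul_le (Or.inl (by simp [Real.exp_pos])) (Or.inl ENNReal.ofReal_ne_top), mul_comm]
  simpa using hm2

lemma coupling_moment (μ ν : Measure ℤ) [IsProbabilityMeasure μ] [IsProbabilityMeasure ν]
    (hμ : IsLogConcavePMF (fun k => (μ {k}).toReal)) (hν : IsLogConcavePMF (fun k => (ν {k}).toReal))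
    (hμc : (∫ x : ℤ, (x : ℝ) ∂μ) = 0) (hνc : (∫ x : ℤ, (x : ℝ) ∂ν) = 0)
    (EX EY : ℝ)
    (hEX : EX = ∫ x : ℤ, |(x : ℝ)| ∂μ) (hEY : EY = ∫ x : ℤ, |(x : ℝ)| ∂ν)
    {r : ℝ} (hr : 1 ≤ r) (π : Measure (ℤ × ℤ)) (h1 : π.map Prod.fst = μ) (h2 : π.map Prod.snd = ν) :
    ∫⁻ x, ENNReal.ofReal (|(x.1 : ℝ) - (x.2 : ℝ)| ^ r) ∂π ≤
      ENNReal.ofReal (Real.Gamma (r + 1) * (2 * (EX + EY + 1)) ^ r) := by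
  have hr0 : 0 < r := by linarith
  have hG : 0 < Real.Gamma (r + 1) := Real.Gamma_pos_of_pos (by linarith)
  have hX0 : 0 ≤ EX := hEX ▸ integral_nonneg fun _ => abs_nonneg _
  have hY0 : 0 ≤ EY := hEY ▸ integral_nonneg fun _ => abs_nonneg _
  have m1 := abs_moment μ hμ hμc hr
  have m2 := abs_moment ν hν hνc hr
  rw [← hEX, ← h1, lintegral_map Measurable.of_discrete measurable_fst] at m1
  rw [← hEY, ← h2, lintegral_map Measurable.of_discrete measurable_snd] at m2
  have hmink := ENNReal.lintegral_Lp_add_le (μ := π) (p := r)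
    (f := fun x : ℤ × ℤ => ENNReal.ofReal |(x.1:ℝ)|) (g := fun x : ℤ × ℤ => ENNReal.ofReal |(x.2:ℝ)|)
    (Measurable.of_discrete).aemeasurable (Measurable.of_discrete).aemeasurable hr
  have hroot : ∀ E : ℝ, 0 ≤ E → (ENNReal.ofReal (Real.Gamma (r + 1) * (2 * E + 1) ^ r)) ^ (1 / r) =
      ENNReal.ofReal (Real.Gamma (r + 1) ^ (1 / r) * (2 * E + 1)) := by
    intro E hE
    rw [ENNReal.ofReal_rpow_of_nonneg (by positivity) (by positivity),
      Real.mul_rpow hG.le (by positivity), ← Real.rpow_mul (by positivity), mul_one_div_cancel hr0.ne',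
      Real.rpow_one]
  simp only [ENNReal.ofReal_rpow_of_nonneg (abs_nonneg _) hr0.le] at hmink
  have n1 := ENNReal.rpow_le_rpow m1 (show 0 ≤ 1 / r by positivity)
  have n2 := ENNReal.rpow_le_rpow m2 (show 0 ≤ 1 / r by positivity)
  rw [hroot _ hX0] at n1
  rw [hroot _ hY0] at n2
  have n3 := hmink.trans (add_le_add n1 n2)
  rw [← ENNReal.ofReal_add (by positivity) (by positivity), ← mul_add] at n3
  have n4 := ENNReal.rpow_le_rpow n3 hr0.le
  rw [← ENNReal.rpow_mul, one_div_mul_cancel hr0.ne', ENNReal.rpow_one,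
    ENNReal.ofReal_rpow_of_nonneg (by positivity) hr0.le, Real.mul_rpow (by positivity) (by positivity),
    ← Real.rpow_mul hG.le, one_div_mul_cancel hr0.ne', Real.rpow_one,
    show 2 * EX + 1 + (2 * EY + 1) = 2 * (EX + EY + 1) by ring] at n4
  refine le_trans (lintegral_mono fun x => ?_) n4
  simp only [Pi.add_apply]
  rw [← ENNReal.ofReal_add (abs_nonneg _) (abs_nonneg _), ENNReal.ofReal_rpow_of_nonneg (by positivity) hr0.le]
  refine ENNReal.ofReal_le_ofReal (Real.rpow_le_rpow (abs_nonneg _) (abs_sub _ _) hr0.le)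

lemma coupling_CS {q A : ℝ} (hq : 1 ≤ q) (hA : 0 ≤ A) (π : Measure (ℤ × ℤ))
    (h : ∫⁻ x, ENNReal.ofReal (|(x.1 : ℝ) - (x.2 : ℝ)| ^ (2 * q)) ∂π ≤ ENNReal.ofReal (A ^ 2))
    (s : Set (ℤ × ℤ)) :
    ∫⁻ x in s, ENNReal.ofReal (|(x.1 : ℝ) - (x.2 : ℝ)| ^ q) ∂π ≤ ENNReal.ofReal A * π s ^ (1 / 2 : ℝ) := by
  have hcs := ENNReal.lintegral_mul_le_Lp_mul_Lq (π.restrict s) (p := 2) (q := 2)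
    (Real.HolderConjugate.two_two)
    (f := fun x : ℤ × ℤ => ENNReal.ofReal (|(x.1 : ℝ) - (x.2 : ℝ)| ^ q)) (g := fun _ => 1)
    (Measurable.of_discrete).aemeasurable (Measurable.of_discrete).aemeasurable
  simp only [Pi.mul_apply, mul_one, ENNReal.one_rpow, lintegral_const, one_mul,
    Measure.restrict_apply_univ] at hcs
  refine hcs.trans ?_
  gcongr
  have e : ∀ x : ℤ × ℤ, ENNReal.ofReal (|(x.1 : ℝ) - (x.2 : ℝ)| ^ q) ^ (2:ℝ) =
      ENNReal.ofReal (|(x.1 : ℝ) - (x.2 : ℝ)| ^ (2 * q)) := by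
    intro x
    rw [ENNReal.ofReal_rpow_of_nonneg (by positivity) (by norm_num), ← Real.rpow_mul (abs_nonneg _), mul_comm]
  simp_rw [e]
  calc _ ≤ (ENNReal.ofReal (A ^ 2)) ^ (1 / 2 : ℝ) := by
        refine ENNReal.rpow_le_rpow ((setLIntegral_le_lintegral _ _).trans h) (by norm_num)
    _ = _ := by
        rw [ENNReal.ofReal_rpow_of_nonneg (by positivity) (by norm_num), ← Real.sqrt_eq_rpow, Real.sqrt_sq hA]

lemma coupling_split (μ ν : Measure ℤ) [IsProbabilityMeasure μ] [IsProbabilityMeasure ν]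
    (hμ : IsLogConcavePMF (fun k => (μ {k}).toReal)) (hν : IsLogConcavePMF (fun k => (ν {k}).toReal))
    (hμc : (∫ x : ℤ, (x : ℝ) ∂μ) = 0) (hνc : (∫ x : ℤ, (x : ℝ) ∂ν) = 0)
    {b : ℝ} (hb1 : 2 * (∫ x : ℤ, |(x:ℝ)| ∂μ) + 1 ≤ b) (hb2 : 2 * (∫ x : ℤ, |(x:ℝ)| ∂ν) + 1 ≤ b)
    {p q A : ℝ} (hp : 1 ≤ p) (hpq : p ≤ q) (hA : 0 ≤ A)
    (π : Measure (ℤ × ℤ)) (h1 : π.map Prod.fst = μ) (h2 : π.map Prod.snd = ν)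
    (h : ∫⁻ x, ENNReal.ofReal (|(x.1 : ℝ) - (x.2 : ℝ)| ^ (2 * q)) ∂π ≤ ENNReal.ofReal (A ^ 2))
    {M : ℝ} (hM : 0 ≤ M) :
    ∫⁻ x, ENNReal.ofReal (|(x.1 : ℝ) - (x.2 : ℝ)| ^ q) ∂π ≤
      ENNReal.ofReal (M ^ (q - p)) * ∫⁻ x, ENNReal.ofReal (|(x.1 : ℝ) - (x.2 : ℝ)| ^ p) ∂π +
      ENNReal.ofReal (2 * A * Real.exp (-M / (8 * b))) := by
  have hE : 0 ≤ ∫ x : ℤ, |(x:ℝ)| ∂μ := integral_nonneg fun _ => abs_nonneg _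
  have hb0 : 0 < b := by linarith
  set s : Set (ℤ × ℤ) := {x | M < |(x.1 : ℝ) - (x.2 : ℝ)|} with hs
  have hsm : MeasurableSet s := MeasurableSet.of_discrete
  rw [← lintegral_add_compl _ hsm, add_comm]
  refine add_le_add ?_ ?_
  · rw [← lintegral_const_mul _ Measurable.of_discrete]
    refine le_trans ?_ (setLIntegral_le_lintegral sᶜ _)
    refine setLIntegral_mono Measurable.of_discrete fun x hx => ?_
    rw [← ENNReal.ofReal_mul (by positivity)]
    refine ENNReal.ofReal_le_ofReal ?_
    have hx' : |(x.1 : ℝ) - (x.2 : ℝ)| ≤ M := by simpa [hs] using hx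
    set d := |(x.1 : ℝ) - (x.2 : ℝ)| with hd
    have hd0 : 0 ≤ d := abs_nonneg _
    rw [show d ^ q = d ^ (q - p) * d ^ p by
      rw [← Real.rpow_add_of_nonneg hd0 (by linarith) (by linarith)]; congr 1; ring]
    gcongr
  · refine (coupling_CS (by linarith) hA π h s).trans ?_
    have hsub : s ⊆ Prod.fst ⁻¹' {x : ℤ | M / 2 ≤ |(x:ℝ)|} ∪ Prod.snd ⁻¹' {x : ℤ | M / 2 ≤ |(x:ℝ)|} := by
      intro x hx
      simp only [hs, Set.mem_ofPred_eq] at hx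
      simp only [Set.mem_union, Set.mem_preimage, Set.mem_ofPred_eq]
      by_contra! hcon
      have := abs_sub (x.1:ℝ) (x.2:ℝ)
      linarith [hcon.1, hcon.2]
    have hps : π s ≤ ENNReal.ofReal ((2 * Real.exp (-M / (8 * b))) ^ 2) := by
      refine (measure_mono hsub).trans ((measure_union_le _ _).trans ?_)
      rw [← Measure.map_apply measurable_fst MeasurableSet.of_discrete,
        ← Measure.map_apply measurable_snd MeasurableSet.of_discrete, h1, h2]
      refine (add_le_add (exp_tail μ hμ hμc hb1 _) (exp_tail ν hν hνc hb2 _)).trans ?_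
      rw [← ENNReal.ofReal_add (by positivity) (by positivity)]
      refine ENNReal.ofReal_le_ofReal (le_of_eq ?_)
      rw [mul_pow, ← Real.exp_nat_mul]
      have : -(M / 2) / (2 * b) = (2:ℕ) * (-M / (8 * b)) := by push_cast; field_simp; norm_num
      rw [this]; ring
    calc _ ≤ ENNReal.ofReal A * (ENNReal.ofReal ((2 * Real.exp (-M / (8 * b))) ^ 2)) ^ (1 / 2 : ℝ) := by
          gcongr
      _ = _ := by
        rw [ENNReal.ofReal_rpow_of_nonneg (by positivity) (by norm_num), ← Real.sqrt_eq_rpow,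
          Real.sqrt_sq (by positivity), ← ENNReal.ofReal_mul hA]
        congr 1; ring

/-- For centered log-concave probability measures `μ, ν` on `ℤ` and `1 ≤ p ≤ q`,
`W_q^q(μ,ν) ≤ 2·W_p^p(μ,ν) + 8^(q−p)·(2·max{E|X|,E|Y|}+1)^(q−p)·W_p^p(μ,ν)·
log^(q−p)(2^q·(E|X|+E|Y|+1)^q·√Γ(2q+1)/W_p^p(μ,ν))`. -/
theorem Wq_le_Wp
    (μ ν : Measure ℤ) [IsProbabilityMeasure μ] [IsProbabilityMeasure ν]
    (hμlc : IsLogConcavePMF (fun k => (μ {k}).toReal))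
    (hνlc : IsLogConcavePMF (fun k => (ν {k}).toReal))
    (hμc : (∫ x : ℤ, (x : ℝ) ∂μ) = 0) (hνc : (∫ x : ℤ, (x : ℝ) ∂ν) = 0)
    (EX EY : ℝ)
    (hEX : EX = ∫ x : ℤ, |(x : ℝ)| ∂μ) (hEY : EY = ∫ x : ℤ, |(x : ℝ)| ∂ν)
    (p q : ℝ) (hp : 1 ≤ p) (hpq : p ≤ q) :
    WassersteinPow q μ ν ≤ 2 * WassersteinPow p μ ν +
      8 ^ (q - p) * (2 * max EX EY + 1) ^ (q - p) * WassersteinPow p μ ν *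
        (Real.log (2 ^ q * (EX + EY + 1) ^ q * Real.sqrt (Real.Gamma (2 * q + 1)) /
          WassersteinPow p μ ν)) ^ (q - p) := by
  have hX0 : 0 ≤ EX := hEX ▸ integral_nonneg fun _ => abs_nonneg _
  have hY0 : 0 ≤ EY := hEY ▸ integral_nonneg fun _ => abs_nonneg _
  have hq : 1 ≤ q := hp.trans hpq
  set A := 2 ^ q * (EX + EY + 1) ^ q * Real.sqrt (Real.Gamma (2 * q + 1)) with hAdef
  set b := 2 * max EX EY + 1 with hb
  have hb1 : 2 * (∫ x : ℤ, |(x:ℝ)| ∂μ) + 1 ≤ b := by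
    rw [← hEX]; have := le_max_left EX EY; linarith
  have hb2 : 2 * (∫ x : ℤ, |(x:ℝ)| ∂ν) + 1 ≤ b := by
    rw [← hEY]; have := le_max_right EX EY; linarith
  have hb0 : 0 < b := by rw [← hEX] at hb1; linarith
  have hG : 0 < Real.Gamma (2 * q + 1) := Real.Gamma_pos_of_pos (by linarith)
  have hA : 0 < A := by
    have := Real.sqrt_pos.2 hG
    positivity
  have hA2 : A ^ 2 = Real.Gamma (2 * q + 1) * (2 * (EX + EY + 1)) ^ (2 * q) := by
    rw [hAdef, mul_pow, Real.sq_sqrt hG.le, ← Real.mul_rpow (by norm_num) (by positivity),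
      ← Real.rpow_mul_natCast (by positivity), mul_comm]
    congr 2; push_cast; ring
  set S := {π : Measure (ℤ × ℤ) | π.map Prod.fst = μ ∧ π.map Prod.snd = ν} with hS
  have hmom : ∀ π ∈ S, ∫⁻ x, ENNReal.ofReal (|(x.1 : ℝ) - (x.2 : ℝ)| ^ (2 * q)) ∂π ≤
      ENNReal.ofReal (A ^ 2) := by
    intro π hπ
    rw [hA2]
    exact coupling_moment μ ν hμlc hνlc hμc hνc EX EY hEX hEY (by linarith) π hπ.1 hπ.2
  set c : ℝ → Measure (ℤ × ℤ) → ENNReal :=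
    fun r π => ∫⁻ x, ENNReal.ofReal (|(x.1 : ℝ) - (x.2 : ℝ)| ^ r) ∂π with hc
  have hW : ∀ r, WassersteinPow r μ ν = (⨅ π ∈ S, c r π).toReal := fun r => rfl
  have hprod : μ.prod ν ∈ S := by
    simp [hS]
  have hcq : ∀ π ∈ S, c q π ≤ ENNReal.ofReal A := by
    intro π hπ
    have h1 := coupling_CS hq hA.le π (hmom π hπ) Set.univ
    have h2 : π Set.univ = 1 := by
      have := congrArg (fun m => m Set.univ) hπ.1
      simpa [Measure.map_apply measurable_fst MeasurableSet.univ] using this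
    rw [h2] at h1
    simpa using h1
  have hcp : ∀ π ∈ S, c p π ≤ c q π := by
    intro π _
    refine lintegral_mono fun x => ENNReal.ofReal_le_ofReal ?_
    by_cases hx : x.1 = x.2
    · rw [hx, sub_self, abs_zero, Real.zero_rpow (by linarith), Real.zero_rpow (by linarith)]
    · refine Real.rpow_le_rpow_of_exponent_le ?_ hpq
      exact_mod_cast Int.one_le_abs (sub_ne_zero.2 hx)
  have hIp : (⨅ π ∈ S, c p π) ≤ ENNReal.ofReal A :=
    (iInf₂_le _ hprod).trans ((hcp _ hprod).trans (hcq _ hprod))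
  have hIpt : (⨅ π ∈ S, c p π) ≠ ⊤ := (hIp.trans_lt ENNReal.ofReal_lt_top).ne
  have hWA : WassersteinPow p μ ν ≤ A := by
    rw [hW]; exact ENNReal.toReal_le_of_le_ofReal hA.le hIp
  have hW0 : 0 ≤ WassersteinPow p μ ν := ENNReal.toReal_nonneg
  have main : ∀ M : ℝ, 0 ≤ M → WassersteinPow q μ ν ≤
      M ^ (q - p) * WassersteinPow p μ ν + 2 * A * Real.exp (-M / (8 * b)) := by
    intro M hM
    have hK : 0 ≤ M ^ (q - p) := by positivity
    refine le_of_forall_pos_le_add fun δ hδ => ?_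
    set ε := δ / (M ^ (q - p) + 1) with hε
    have hε0 : 0 < ε := by positivity
    have hlt : (⨅ π ∈ S, c p π) < ENNReal.ofReal (WassersteinPow p μ ν + ε) := by
      rw [ENNReal.lt_ofReal_iff_toReal_lt hIpt, ← hW]; linarith
    obtain ⟨π, hπ⟩ := iInf_lt_iff.1 hlt
    obtain ⟨hπS, hπ⟩ := iInf_lt_iff.1 hπ
    have h1 := coupling_split μ ν hμlc hνlc hμc hνc hb1 hb2 hp hpq hA.le π hπS.1 hπS.2 (hmom π hπS) hM
    have h2 : (⨅ π ∈ S, c q π) ≤ ENNReal.ofReal (M ^ (q - p) * (WassersteinPow p μ ν + ε) +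
        2 * A * Real.exp (-M / (8 * b))) := by
      refine (iInf₂_le _ hπS).trans (h1.trans ?_)
      rw [ENNReal.ofReal_add (by positivity) (by positivity), ENNReal.ofReal_mul hK]
      gcongr
    have h3 := ENNReal.toReal_le_of_le_ofReal (by positivity) h2
    rw [← hW] at h3
    have h4 : M ^ (q - p) * ε ≤ δ := by
      rw [hε, mul_div_assoc', div_le_iff₀ (by positivity)]; nlinarith
    linarith
  rcases hW0.eq_or_lt with h0 | h0
  · rw [← h0] at main ⊢
    simp only [mul_zero, zero_mul, add_zero, zero_add] at main ⊢
    have hlim : Filter.Tendsto (fun M : ℝ => 2 * A * Real.exp (-M / (8 * b))) Filter.atTop (nhds (2 * A * 0)) := by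
      refine Filter.Tendsto.const_mul _ (Real.tendsto_exp_atBot.comp ?_)
      exact Filter.tendsto_neg_atTop_atBot.atBot_div_const (by positivity)
    rw [mul_zero] at hlim
    exact ge_of_tendsto hlim ((Filter.eventually_ge_atTop 0).mono main)
  · set W := WassersteinPow p μ ν with hWd
    have hlog : 0 ≤ Real.log (A / W) := Real.log_nonneg ((one_le_div h0).2 hWA)
    have := main (8 * b * Real.log (A / W)) (by positivity)
    rw [show -(8 * b * Real.log (A / W)) / (8 * b) = -Real.log (A / W) by field_simp, Real.exp_neg,
      Real.exp_log (by positivity), Real.mul_rpow (by positivity) hlog,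
      Real.mul_rpow (by positivity) hb0.le, inv_div, show 2 * A * (W / A) = 2 * W by field_simp] at this
    linarith
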